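/- arXiv:2604.04597 — 5 statements merged into one kernel-verified Lean document; each statement's English description precedes it below -/
import Mathlib

section
/- Let Γ = (V, E, src, rng) be a directed graph, A a C*-algebra, and (p, s) a Cuntz–Krieger Γ-family in A. Fix a sink v_s ∈ V, a vertex v_* ∈ V with v_* ≠ v_s, and an injective map c from {e ∈ E : rng e = v_*} to {e ∈ E : rng e = v_s} satisfying src(c e) = src e for every e. Define P_v := p_v for v ∉ {v_s, v_*}, P_{v_*} := p_{v_*} + p_{v_s}, and S_e := s_e if rng e ≠ v_*, S_e := s_e + s_{c e} if rng e = v_*. Then (P, S), indexed by the vertices v ≠ v_s and the edges e with rng e ≠ v_s, is a Cuntz–Krieger family for the graph Γ \ {v_s}: each P_v is a projection, P_v · P_w = 0 for v ≠ w, S_e* · S_f = 0 for e ≠ f, S_e* · S_e = P_{rng e}, and S_e · S_e* ≤ P_{src e}. Moreover, if V is finite, then Σ_{v ∈ V, v ≠ v_s} P_v = Σ_{v ∈ V} p_v. (This is the relation-theoretic content of the paper's main theorem: by the universal property of graph C*-algebras, it says that σ(p_v) := P_v, σ(s_e) := S_e defines a unital *-homomorphism σ : C*(Γ\{v_s}) →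 C*(Γ) splitting the quotient map.) -/
/-- In a C*-ring, an element `a` whose initial space is a projection `q = a* a` satisfies
`a q = a`. -/
theorem mul_eq_self_of_star_mul_self_eq {A : Type*} [NormedRing A] [StarRing A] [CStarRing A]
    {a q : A} (hsa : star q = q) (hidem : q * q = q) (h : star a * a = q) : a * q = a := by
  have key : star (a * q - a) * (a * q - a) = 0 := by
    have expand : star (a * q - a) * (a * q - a)
        = q * (star a * a) * q - q * (star a * a) - star a * a * q + star a * a := by
      rw [star_sub, star_mul, hsa]; noncomm_ring
    rw [expand, h, hidem, hidem]; abel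
  exact sub_eq_zero.mp (CStarRing.star_mul_self_eq_zero_iff _ |>.mp key)

/-- In an ordered C*-ring, if `a a*` lies below a projection `q`, then `q a = a`. -/
theorem mul_eq_self_of_mul_star_le {A : Type*} [NormedRing A] [StarRing A] [CStarRing A]
    [PartialOrder A] [StarOrderedRing A]
    {a q : A} (hsa : star q = q) (hidem : q * q = q) (h : a * star a ≤ q) : q * a = a := by
  have hsa' : star (1 - q) = 1 - q := by rw [star_sub, star_one, hsa]
  have hzero : (1 - q) * q = 0 := by rw [sub_mul, one_mul, hidem, sub_self]
  have hconj := star_right_conjugate_le_conjugate h (1 - q)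
  have expand : (1 - q) * (a * star a) * star (1 - q)
      = ((1 - q) * a) * star ((1 - q) * a) := by
    rw [star_mul]; noncomm_ring
  rw [hzero, zero_mul, expand] at hconj
  have key := (CStarRing.mul_star_self_eq_zero_iff _).mp
    (le_antisymm hconj (mul_star_self_nonneg _))
  rw [sub_mul, one_mul] at key
  exact (sub_eq_zero.mp key).symm

/-- If `a` is a partial isometry and `q` is a projection with `q a = a`, then `a a* ≤ q`. -/
theorem mul_star_le_of_mul_eq_self {A : Type*} [Ring A] [StarRing A]
    [PartialOrder A] [StarOrderedRing A] {a q : A} (hsa : star q = q) (hidem : q * q = q)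
    (ha : a * (star a * a) = a) (hqa : q * a = a) : a * star a ≤ q := by
  have haq : star a * q = star a := by
    simpa only [star_mul, hsa] using congrArg star hqa
  have hsq : star (q - a * star a) * (q - a * star a) = q - a * star a := by
    have expand : star (q - a * star a) * (q - a * star a)
        = q * q - (q * a) * star a - a * (star a * q) + a * (star a * a) * star a := by
      rw [star_sub, star_mul, star_star, hsa]; noncomm_ring
    rw [expand, hidem, hqa, haq, ha]; abel
  rw [← sub_nonneg, ← hsq]
  exact star_mul_self_nonneg _


/-- **Relation-theoretic content of the main splitting theorem** (Theorem 4.1 of the paper).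
Given a Cuntz–Krieger `Γ`-family `(p, s)` in a C*-algebra `A`, a sink `v_s`, a designated
vertex `v_*` and an injective source-preserving map `c` from edges into `v_*` to edges into
`v_s`, the modified family `(P, S)` defined by `P v = p v` (for `v ∉ {v_s, v_*}`),
`P v_* = p v_* + p v_s`, `S e = s e` (for `rng e ≠ v_*`), `S e = s e + s (c e)`
(for `rng e = v_*`) is a Cuntz–Krieger family for the graph `Γ \ {v_s}`; moreover, when `V`
is finite, the sum of the new vertex projections equals the sum of all of the old ones. -/
theorem amplified_graph_splitting_family
    {V E A : Type*} [Fintype V] [DecidableEq V]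
    [NormedRing A] [StarRing A] [CStarRing A] [NormedAlgebra ℂ A] [StarModule ℂ A]
    [PartialOrder A] [StarOrderedRing A]
    (src rng : E → V) (p : V → A) (s : E → A)
    -- `(p, s)` is a Cuntz–Krieger `Γ`-family:
    (hp_sa : ∀ v, star (p v) = p v) (hp_idem : ∀ v, p v * p v = p v)
    (hp_orth : ∀ v w, v ≠ w → p v * p w = 0)
    (hs_orth : ∀ e f, e ≠ f → star (s e) * s f = 0)
    (hCK1 : ∀ e, star (s e) * s e = p (rng e))
    (hCK2 : ∀ e, s e * star (s e) ≤ p (src e))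
    -- the sink `v_s`, the designated vertex `v_*`, and the edge-matching map `c`:
    (v_s v_star : V) (hsink : ∀ e, src e ≠ v_s) (hne : v_star ≠ v_s)
    (c : {e : E // rng e = v_star} → {e : E // rng e = v_s})
    (hc_inj : Function.Injective c)
    (hc_src : ∀ e, src (c e).1 = src e.1)
    -- the modified family `(P, S)`:
    (P : V → A) (S : E → A)
    (hP : ∀ v, P v = if v = v_star then p v_star + p v_s else p v)
    (hS : ∀ e, S e = if h : rng e = v_star then s e + s (c ⟨e, h⟩).1 else s e) :
    -- the `P v`, `v ≠ v_s`, are mutually orthogonal projections: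
    (∀ v, v ≠ v_s → star (P v) = P v ∧ P v * P v = P v) ∧
    (∀ v w, v ≠ v_s → w ≠ v_s → v ≠ w → P v * P w = 0) ∧
    -- the `S e`, `rng e ≠ v_s`, have orthogonal ranges:
    (∀ e f, rng e ≠ v_s → rng f ≠ v_s → e ≠ f → star (S e) * S f = 0) ∧
    -- (CK1) for the new family:
    (∀ e, rng e ≠ v_s → star (S e) * S e = P (rng e)) ∧
    -- (CK2) for the new family:
    (∀ e, rng e ≠ v_s → S e * star (S e) ≤ P (src e)) ∧
    -- unitality: the sum over `V \ {v_s}` of the new projections is the sum of all old ones: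
    (∑ v ∈ Finset.univ.filter (fun v => v ≠ v_s), P v = ∑ v, p v) := by
  have hpS : ∀ e, p (src e) * s e = s e := fun e =>
    mul_eq_self_of_mul_star_le (hp_sa _) (hp_idem _) (hCK2 e)
  have hproj : ∀ v, star (P v) = P v ∧ P v * P v = P v := by
    intro v
    rw [hP]
    split_ifs
    · simp [add_mul, mul_add, hp_sa, hp_idem, hp_orth _ _ hne, hp_orth _ _ hne.symm]
    · exact ⟨hp_sa v, hp_idem v⟩
  have hc_ne : ∀ e f, rng f ≠ v_s → (c e).1 ≠ f := by
    rintro e f hf rfl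
    exact hf (c e).2
  have hCK1' : ∀ e, rng e ≠ v_s → star (S e) * S e = P (rng e) := by
    intro e he
    rw [hP, hS]
    split_ifs with h
    · have hce := hc_ne ⟨e, h⟩ e he
      rw [star_add, add_mul, mul_add, mul_add, hs_orth _ _ hce, hs_orth _ _ hce.symm,
        hCK1, hCK1, (c ⟨e, h⟩).2, h, add_zero, zero_add]
    · exact hCK1 e
  have hPs : ∀ e, P (src e) * s e = s e := by
    intro e
    rw [hP]
    split_ifs with h
    · have hzero : p v_s * s e = 0 := by
        rw [← hpS e, ← mul_assoc, hp_orth _ _ (hsink e).symm, zero_mul]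
      rw [add_mul, hzero, add_zero, ← h, hpS]
    · exact hpS e
  have hPS : ∀ e, P (src e) * S e = S e := by
    intro e
    rw [hS]
    split_ifs with h
    · have hPc := hPs (c ⟨e, h⟩).1
      rw [hc_src] at hPc
      rw [mul_add, hPs, hPc]
    · exact hPs e
  refine ⟨fun v _ => hproj v, ?_, ?_, hCK1', ?_, ?_⟩
  · intro v w hv hw hvw
    rw [hP, hP]
    split_ifs with h h' h'
    · exact absurd (h.trans h'.symm) hvw
    · rw [add_mul, hp_orth _ _ (Ne.symm h'), hp_orth _ _ hw.symm, add_zero]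
    · rw [mul_add, hp_orth _ _ h, hp_orth _ _ hv, add_zero]
    · exact hp_orth _ _ hvw
  · intro e f he hf hef
    rw [hS, hS]
    split_ifs with h h' h'
    · have hcc : (c ⟨e, h⟩).1 ≠ (c ⟨f, h'⟩).1 := fun heq =>
        hef (congrArg Subtype.val (hc_inj (Subtype.ext heq)))
      rw [star_add, add_mul, mul_add, mul_add, hs_orth _ _ hef, hs_orth _ _ hcc,
        hs_orth _ _ (hc_ne _ _ he).symm, hs_orth _ _ (hc_ne _ _ hf), add_zero, add_zero]
    · rw [star_add, add_mul, hs_orth _ _ hef, hs_orth _ _ (hc_ne _ _ hf), add_zero]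
    · rw [mul_add, hs_orth _ _ hef, hs_orth _ _ (hc_ne _ _ he).symm, add_zero]
    · exact hs_orth _ _ hef
  · intro e he
    have hSe : S e * (star (S e) * S e) = S e := by
      rw [hCK1' e he]
      exact mul_eq_self_of_star_mul_self_eq (hproj _).1 (hproj _).2 (hCK1' e he)
    exact mul_star_le_of_mul_eq_self (hproj _).1 (hproj _).2 hSe (hPS e)
  · have hmem : v_star ∈ Finset.univ.erase v_s :=
      Finset.mem_erase.mpr ⟨hne, Finset.mem_univ _⟩
    have hP_rest : ∀ v ∈ (Finset.univ.erase v_s).erase v_star, P v = p v := fun v hv => by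
      rw [hP, if_neg (Finset.ne_of_mem_erase hv)]
    rw [Finset.filter_ne', ← Finset.add_sum_erase _ _ hmem, Finset.sum_congr rfl hP_rest,
      hP, if_pos rfl, ← Finset.add_sum_erase _ p (Finset.mem_univ v_s),
      ← Finset.add_sum_erase _ p hmem]
    abel
end

section
/- Let Γ = (V, E, src, rng) be a directed graph, A a C*-algebra, and (p, s) a Cuntz–Krieger Γ-family in A. Fix a sink v_s ∈ V, a vertex v_* ∈ V with v_* ≠ v_s, and an injective map c from {e ∈ E : rng e = v_*} to {e ∈ E : rng e = v_s} satisfying src(c e) = src e for every e. Define P_v := p_v for v ∉ {v_s, v_*}, P_{v_*} := p_{v_*} + p_{v_s}, and S_e := s_e if rng e ≠ v_*, S_e := s_e + s_{c e} if rng e = v_*. Then for every edge e with rng e ≠ v_s one has S_e* · S_e = P_{rng e}; in particular, for an edge e with rng e = v_*, (s_e + s_{c e})* · (s_e + s_{c e}) = p_{v_*} + p_{v_s}. -/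
/-- The (CK1) relation for the modified family in the proof of the main splitting theorem:
for every edge `e` with `rng e ≠ v_s` one has `S e* · S e = P (rng e)`; in particular
for an edge `e` into `v_*`, `(s e + s (c e))* (s e + s (c e)) = p v_* + p v_s`. -/
theorem splitting_family_CK1
    {V E A : Type*} [DecidableEq V]
    [NormedRing A] [StarRing A] [CStarRing A] [NormedAlgebra ℂ A] [StarModule ℂ A]
    [PartialOrder A] [StarOrderedRing A]
    (src rng : E → V) (p : V → A) (s : E → A)
    (hp_sa : ∀ v, star (p v) = p v) (hp_idem : ∀ v, p v * p v = p v)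
    (hp_orth : ∀ v w, v ≠ w → p v * p w = 0)
    (hs_orth : ∀ e f, e ≠ f → star (s e) * s f = 0)
    (hCK1 : ∀ e, star (s e) * s e = p (rng e))
    (hCK2 : ∀ e, s e * star (s e) ≤ p (src e))
    (v_s v_star : V) (hsink : ∀ e, src e ≠ v_s) (hne : v_star ≠ v_s)
    (c : {e : E // rng e = v_star} → {e : E // rng e = v_s})
    (hc_inj : Function.Injective c)
    (hc_src : ∀ e, src (c e).1 = src e.1)
    (P : V → A) (S : E → A)
    (hP : ∀ v, P v = if v = v_star then p v_star + p v_s else p v)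
    (hS : ∀ e, S e = if h : rng e = v_star then s e + s (c ⟨e, h⟩).1 else s e) :
    (∀ e, rng e ≠ v_s → star (S e) * S e = P (rng e)) ∧
    (∀ e, ∀ h : rng e = v_star,
      star (s e + s (c ⟨e, h⟩).1) * (s e + s (c ⟨e, h⟩).1) = p v_star + p v_s) := by
  have key : ∀ e, ∀ h : rng e = v_star,
      star (s e + s (c ⟨e, h⟩).1) * (s e + s (c ⟨e, h⟩).1) = p v_star + p v_s := by
    intro e h
    have hc_rng : rng (c ⟨e, h⟩).1 = v_s := (c ⟨e, h⟩).2
    have hec : e ≠ (c ⟨e, h⟩).1 := fun he =>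
      hne (h.symm.trans ((congrArg rng he).trans hc_rng))
    rw [star_add, add_mul, mul_add, mul_add, hs_orth _ _ hec, hs_orth _ _ hec.symm,
      hCK1, hCK1, h, hc_rng, add_zero, zero_add]
  refine ⟨fun e _ => ?_, key⟩
  by_cases h : rng e = v_star
  · rw [hS, hP, dif_pos h, if_pos h, key e h]
  · rw [hS, hP, dif_neg h, if_neg h, hCK1]
end

section
/- Let Γ = (V, E, src, rng) be a directed graph, A a C*-algebra, and (p, s) a Cuntz–Krieger Γ-family in A. Fix a sink v_s ∈ V, a vertex v_* ∈ V with v_* ≠ v_s, and an injective map c from {e ∈ E : rng e = v_*} to {e ∈ E : rng e = v_s} satisfying src(c e) = src e for every e. Define S_e := s_e if rng e ≠ v_*, S_e := s_e + s_{c e} if rng e = v_*. Then for all edges e ≠ f with rng e ≠ v_s and rng f ≠ v_s one has S_e* · S_f = 0. -/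
/-- Orthogonality of the ranges of the modified partial isometries in the proof of the main
splitting theorem: for edges `e ≠ f`, neither ranging at the sink `v_s`, one has
`S e* · S f = 0`. -/
theorem splitting_family_range_orthogonality
    {V E A : Type*} [DecidableEq V]
    [NormedRing A] [StarRing A] [CStarRing A] [NormedAlgebra ℂ A] [StarModule ℂ A]
    [PartialOrder A] [StarOrderedRing A]
    (src rng : E → V) (p : V → A) (s : E → A)
    (hp_sa : ∀ v, star (p v) = p v) (hp_idem : ∀ v, p v * p v = p v)
    (hp_orth : ∀ v w, v ≠ w → p v * p w = 0)
    (hs_orth : ∀ e f, e ≠ f → star (s e) * s f = 0)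
    (hCK1 : ∀ e, star (s e) * s e = p (rng e))
    (hCK2 : ∀ e, s e * star (s e) ≤ p (src e))
    (v_s v_star : V) (hsink : ∀ e, src e ≠ v_s) (hne : v_star ≠ v_s)
    (c : {e : E // rng e = v_star} → {e : E // rng e = v_s})
    (hc_inj : Function.Injective c)
    (hc_src : ∀ e, src (c e).1 = src e.1)
    (S : E → A)
    (hS : ∀ e, S e = if h : rng e = v_star then s e + s (c ⟨e, h⟩).1 else s e) :
    ∀ e f, rng e ≠ v_s → rng f ≠ v_s → e ≠ f → star (S e) * S f = 0 := by
  intro e f he hf hef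
  have hec : ∀ h, star (s e) * s (c h).1 = 0 := fun h =>
    hs_orth _ _ fun heq => he (heq ▸ (c h).2)
  have hcf : ∀ h, star (s (c h).1) * s f = 0 := fun h =>
    hs_orth _ _ fun heq => hf (heq ▸ (c h).2)
  have hcc : ∀ h h', star (s (c ⟨e, h⟩).1) * s (c ⟨f, h'⟩).1 = 0 := fun h h' =>
    hs_orth _ _ fun heq => hef (congrArg Subtype.val (hc_inj (Subtype.ext heq)))
  rw [hS e, hS f]
  split_ifs <;> simp [add_mul, mul_add, hs_orth e f hef, hec, hcf, hcc]
end

section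
/- Let Γ = (V, E, src, rng) be a directed graph, A a C*-algebra, and (p, s) a Cuntz–Krieger Γ-family in A. Fix a sink v_s ∈ V, a vertex v_* ∈ V with v_* ≠ v_s, and an injective map c from {e ∈ E : rng e = v_*} to {e ∈ E : rng e = v_s} satisfying src(c e) = src e for every e. Define P_v := p_v for v ∉ {v_s, v_*}, P_{v_*} := p_{v_*} + p_{v_s}, and S_e := s_e if rng e ≠ v_*, S_e := s_e + s_{c e} if rng e = v_*. Then for every edge e with rng e ≠ v_s one has S_e · S_e* ≤ P_{src e}; in particular, for an edge e with rng e = v_*, s_e · s_{c e}* = 0 and (s_e + s_{c e}) · (s_e + s_{c e})* = s_e s_e* + s_{c e} s_{c e}* ≤ P_{src e}. -/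
section PartialIsometry

variable {A : Type*} [NormedRing A] [StarRing A] [CStarRing A]

/-- An element whose initial-space element `star a * a` is idempotent is a partial isometry. -/
lemma mul_star_mul_self_of_isIdempotentElem {a : A} (h : IsIdempotentElem (star a * a)) :
    a * (star a * a) = a := by
  rw [← sub_eq_zero, ← CStarRing.star_mul_self_eq_zero_iff]
  have h' : star a * a * (star a * a) = star a * a := h
  calc star (a * (star a * a) - a) * (a * (star a * a) - a)
      = star a * a * (star a * a) * (star a * a) - star a * a * (star a * a)
        - (star a * a * (star a * a) - star a * a) := by
        simp only [star_sub, star_mul, star_star]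
        noncomm_ring
    _ = 0 := by simp [h']

/-- The final projection of a partial isometry. -/
lemma isStarProjection_mul_star_of_isIdempotentElem {a : A}
    (h : IsIdempotentElem (star a * a)) : IsStarProjection (a * star a) where
  isIdempotentElem := by
    have := mul_star_mul_self_of_isIdempotentElem h
    rw [IsIdempotentElem, ← mul_assoc, mul_assoc a, this]
  isSelfAdjoint := .mul_star_self a

/-- Partial isometries with orthogonal initial projections satisfy `a * star b = 0`. -/
lemma mul_star_eq_zero_of_orthogonal_initial {a b : A}
    (ha : IsIdempotentElem (star a * a)) (hb : IsIdempotentElem (star b * b))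
    (hab : star a * a * (star b * b) = 0) : a * star b = 0 := by
  have hb' : star b * b * star b = star b := by
    simpa [mul_assoc] using congrArg star (mul_star_mul_self_of_isIdempotentElem hb)
  calc a * star b = a * (star a * a) * (star b * b * star b) := by
        rw [mul_star_mul_self_of_isIdempotentElem ha, hb']
    _ = a * (star a * a * (star b * b)) * star b := by noncomm_ring
    _ = 0 := by simp [hab]

variable [PartialOrder A] [StarOrderedRing A]

/-- A projection dominated by a projection `p` is fixed by right multiplication by `p`. -/
lemma IsStarProjection.mul_eq_left_of_le {q p : A} (hq : IsStarProjection q)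
    (hp : IsStarProjection p) (hqp : q ≤ p) : q * p = q := by
  have hp' : p * p = p := hp.isIdempotentElem
  have hq' : q * q = q := hq.isIdempotentElem
  have hsp : star p = p := hp.isSelfAdjoint
  have hsq : star q = q := hq.isSelfAdjoint
  have key : star (q * (1 - p)) * (q * (1 - p)) = star (1 - p) * q * (1 - p) := by
    calc star (q * (1 - p)) * (q * (1 - p)) = star (1 - p) * (q * q) * (1 - p) := by
          simp only [star_mul, hsq]
          noncomm_ring
      _ = _ := by rw [hq']
  have hle : star (1 - p) * q * (1 - p) ≤ 0 := by
    refine (star_left_conjugate_le_conjugate hqp (1 - p)).trans_eq ?_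
    rw [mul_assoc, mul_sub, mul_one, hp', sub_self, mul_zero]
  have hz := le_antisymm (key ▸ hle) (star_mul_self_nonneg (q * (1 - p)))
  rw [CStarRing.star_mul_self_eq_zero_iff, mul_sub, mul_one, sub_eq_zero] at hz
  exact hz.symm

/-- The sum of two orthogonal projections dominated by a projection `p` is dominated by `p`. -/
lemma IsStarProjection.add_le_of_le {q r p : A} (hq : IsStarProjection q)
    (hr : IsStarProjection r) (hp : IsStarProjection p) (hqr : q * r = 0)
    (hqp : q ≤ p) (hrp : r ≤ p) : q + r ≤ p := by
  have hs : IsStarProjection (q + r) := hq.add hr hqr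
  have h : (q + r) * p = q + r := by
    rw [add_mul, hq.mul_eq_left_of_le hp hqp, hr.mul_eq_left_of_le hp hrp]
  have h' : p * (q + r) = q + r := by
    simpa only [star_mul, hp.isSelfAdjoint.star_eq, hs.isSelfAdjoint.star_eq]
      using congrArg star h
  have hpp : p * p = p := hp.isIdempotentElem
  have hss : (q + r) * (q + r) = q + r := hs.isIdempotentElem
  have heq : star (p - (q + r)) * (p - (q + r)) = p - (q + r) := by
    rw [star_sub, hp.isSelfAdjoint.star_eq, hs.isSelfAdjoint.star_eq, sub_mul, mul_sub, mul_sub,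
      hpp, h, h', hss]
    abel
  rw [← sub_nonneg, ← heq]
  exact star_mul_self_nonneg _

end PartialIsometry


/-- The (CK2) relation for the modified family in the proof of the main splitting theorem:
for every edge `e` with `rng e ≠ v_s` one has `S e · S e* ≤ P (src e)`; in particular,
for an edge `e` into `v_*` one has `s e · (s (c e))* = 0` and
`(s e + s (c e)) (s e + s (c e))* = s e s e* + s (c e) (s (c e))* ≤ P (src e)`. -/
theorem splitting_family_CK2
    {V E A : Type*} [DecidableEq V]
    [NormedRing A] [StarRing A] [CStarRing A] [NormedAlgebra ℂ A] [StarModule ℂ A]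
    [PartialOrder A] [StarOrderedRing A]
    (src rng : E → V) (p : V → A) (s : E → A)
    (hp_sa : ∀ v, star (p v) = p v) (hp_idem : ∀ v, p v * p v = p v)
    (hp_orth : ∀ v w, v ≠ w → p v * p w = 0)
    (hs_orth : ∀ e f, e ≠ f → star (s e) * s f = 0)
    (hCK1 : ∀ e, star (s e) * s e = p (rng e))
    (hCK2 : ∀ e, s e * star (s e) ≤ p (src e))
    (v_s v_star : V) (hsink : ∀ e, src e ≠ v_s) (hne : v_star ≠ v_s)
    (c : {e : E // rng e = v_star} → {e : E // rng e = v_s})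
    (hc_inj : Function.Injective c)
    (hc_src : ∀ e, src (c e).1 = src e.1)
    (P : V → A) (S : E → A)
    (hP : ∀ v, P v = if v = v_star then p v_star + p v_s else p v)
    (hS : ∀ e, S e = if h : rng e = v_star then s e + s (c ⟨e, h⟩).1 else s e) :
    (∀ e, rng e ≠ v_s → S e * star (S e) ≤ P (src e)) ∧
    (∀ e, ∀ h : rng e = v_star,
      s e * star (s (c ⟨e, h⟩).1) = 0 ∧
      (s e + s (c ⟨e, h⟩).1) * star (s e + s (c ⟨e, h⟩).1)
        = s e * star (s e) + s (c ⟨e, h⟩).1 * star (s (c ⟨e, h⟩).1) ∧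
      s e * star (s e) + s (c ⟨e, h⟩).1 * star (s (c ⟨e, h⟩).1) ≤ P (src e)) := by
  have hp : ∀ v, IsStarProjection (p v) := fun v => ⟨hp_idem v, hp_sa v⟩
  have hs : ∀ e, IsIdempotentElem (star (s e) * s e) := fun e => by
    rw [hCK1]; exact hp_idem _
  have hpP : ∀ v, p v ≤ P v := fun v => by
    rw [hP]
    split_ifs with h
    · subst h
      refine le_add_of_nonneg_right ?_
      rw [← hp_idem v_s]
      nth_rewrite 1 [← hp_sa v_s]
      exact star_mul_self_nonneg _
    · exact le_rfl
  have main : ∀ e, ∀ h : rng e = v_star,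
      s e * star (s (c ⟨e, h⟩).1) = 0 ∧
      (s e + s (c ⟨e, h⟩).1) * star (s e + s (c ⟨e, h⟩).1)
        = s e * star (s e) + s (c ⟨e, h⟩).1 * star (s (c ⟨e, h⟩).1) ∧
      s e * star (s e) + s (c ⟨e, h⟩).1 * star (s (c ⟨e, h⟩).1) ≤ P (src e) := by
    intro e h
    have hf := (c ⟨e, h⟩).2
    have hsrc : src (c ⟨e, h⟩).1 = src e := hc_src ⟨e, h⟩
    generalize (c ⟨e, h⟩).1 = f at hf hsrc ⊢
    have hrng : rng e ≠ rng f := by rwa [h, hf]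
    have hef : e ≠ f := fun H => hrng (congrArg rng H)
    have h0 : s e * star (s f) = 0 :=
      mul_star_eq_zero_of_orthogonal_initial (hs e) (hs f) (by
        rw [hCK1, hCK1, hp_orth _ _ hrng])
    have h0' : s f * star (s e) = 0 := by simpa using congrArg star h0
    refine ⟨h0, ?_, le_trans ?_ (hpP _)⟩
    · rw [star_add, add_mul, mul_add, mul_add, h0, h0', add_zero, zero_add]
    · refine (isStarProjection_mul_star_of_isIdempotentElem (hs e)).add_le_of_le
        (isStarProjection_mul_star_of_isIdempotentElem (hs f)) (hp _) ?_ (hCK2 e)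
        (hsrc ▸ hCK2 f)
      rw [← mul_assoc, mul_assoc (s e), hs_orth e f hef, mul_zero, zero_mul]
  refine ⟨fun e _ => ?_, main⟩
  rw [hS]
  split_ifs with h
  · obtain ⟨-, h1, h2⟩ := main e h
    exact h1.trans_le h2
  · exact (hCK2 e).trans (hpP _)
end

section
/- Let X and Y be compact Hausdorff topological spaces and let ι : Y → X be a continuous injective map. Then the following are equivalent: (1) there exists a unital star-algebra homomorphism Φ : C(Y, ℂ) → C(X, ℂ) such that (Φ f) ∘ ι = f for every f ∈ C(Y, ℂ); (2) there exists a continuous map r : X → Y such that r ∘ ι = id on Y (i.e. Y is a retract of X via ι). -/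
/-- Gelfand-duality translation between splittings of the restriction map
`C(X) → C(Y)` and topological retractions `X → Y`: for compact Hausdorff `X, Y` and a
continuous injection `ι : Y → X`, there exists a unital *-homomorphism
`Φ : C(Y, ℂ) → C(X, ℂ)` with `(Φ f) ∘ ι = f` for all `f` if and only if `Y` is a
retract of `X` via `ι`. -/
theorem starAlgHom_splitting_iff_retract
    {X Y : Type*} [TopologicalSpace X] [CompactSpace X] [T2Space X]
    [TopologicalSpace Y] [CompactSpace Y] [T2Space Y]
    (ι : Y → X) (hι_cont : Continuous ι) (hι_inj : Function.Injective ι) :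
    (∃ Φ : C(Y, ℂ) →⋆ₐ[ℂ] C(X, ℂ), ∀ (f : C(Y, ℂ)) (y : Y), Φ f (ι y) = f y) ↔
    (∃ r : X → Y, Continuous r ∧ ∀ y : Y, r (ι y) = y) := by
  constructor
  · rintro ⟨Φ, hΦ⟩
    let r : X → Y := fun x ↦ (WeakDual.CharacterSpace.homeoEval Y ℂ).symm
      (WeakDual.CharacterSpace.compContinuousMap Φ (WeakDual.CharacterSpace.homeoEval X ℂ x))
    refine ⟨r, (Homeomorph.continuous _).comp ((ContinuousMap.continuous _).comp
      (Homeomorph.continuous _)), fun y ↦ ?_⟩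
    rw [Homeomorph.symm_apply_eq]
    exact WeakDual.CharacterSpace.ext fun f ↦ hΦ f y
  · rintro ⟨r, hr, hrι⟩
    exact ⟨ContinuousMap.compStarAlgHom' ℂ ℂ ⟨r, hr⟩, fun f y ↦ congrArg f (hrι y)⟩
end
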